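/- Suppose χ is a primitive Dirichlet character modulo N_β, let g = gcd(N_β, N_β(γ,β)), and let p be a prime dividing g such that N_β is a power of p, i.e., N_β = p^{ν_p(N_β)}. Then G_{γ,n}(p^α; β, χ) = 0 for all integers α with 0 ≤ α < ν_p(g). -/

import Mathlib

open Finset Matrix

namespace EisensteinWeil

variable {m : ℕ}

/-- The bilinear form `(x,y) = xᵀ S y` on `ℚ^m`. -/
def bil (S : Matrix (Fin m) (Fin m) ℤ) (x y : Fin m → ℚ) : ℚ :=
  x ⬝ᵥ (S.map (Int.cast : ℤ → ℚ)).mulVec y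

/-- The quadratic form `Q(x) = (x,x)/2`. -/
def Qf (S : Matrix (Fin m) (Fin m) ℤ) (x : Fin m → ℚ) : ℚ := bil S x x / 2

/-- Membership in the dual lattice `L' = S⁻¹ℤ^m`: `x ∈ L'` iff `(x,r) ∈ ℤ` for all `r ∈ ℤ^m`. -/
def memDual (S : Matrix (Fin m) (Fin m) ℤ) (γ : Fin m → ℚ) : Prop :=
  ∀ r : Fin m → ℤ, ∃ z : ℤ, bil S γ (fun i => (r i : ℚ)) = z

/-- `N` is the order of `γ + ℤ^m` in `L'/ℤ^m`, i.e. the smallest positive integer with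
`N • γ ∈ ℤ^m`. -/
def isOrderOf (γ : Fin m → ℚ) (N : ℕ) : Prop :=
  0 < N ∧ (∀ i, ∃ z : ℤ, (N : ℚ) * γ i = z) ∧
    ∀ k : ℕ, 0 < k → (∀ i, ∃ z : ℤ, (k : ℚ) * γ i = z) → N ≤ k

/-- The representation number `N_{γ,n}(a)`, counting `r ∈ (ℤ^m)/(aℤ^m)`
(represented by `r : Fin m → Fin a`) with `Q(r − γ) + n ≡ 0 (mod a)`. -/
noncomputable def repNum (S : Matrix (Fin m) (Fin m) ℤ) (γ : Fin m → ℚ) (n : ℚ) (a : ℕ) : ℕ :=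
  Nat.card {r : Fin m → Fin a //
    ∃ t : ℤ, Qf S ((fun i => ((r i : ℕ) : ℚ)) - γ) + n = (a : ℚ) * t}

/-- `e(x) = e^{2πix}`. -/
noncomputable def eQ (x : ℚ) : ℂ := Complex.exp (2 * Real.pi * Complex.I * (x : ℂ))

/-- A canonical choice of inverse of `d` modulo `c`. -/
def adInv (c d : ℕ) : ℕ := ((d : ZMod c)⁻¹).val

/-- The sum `G_{γ,n}(c; β, χ)`. -/
noncomputable def Gsum (S : Matrix (Fin m) (Fin m) ℤ) (γ : Fin m → ℚ) (n : ℚ)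
    (β : Fin m → ℚ) (Nβ : ℕ) (χ : DirichletCharacter ℂ Nβ) (c : ℕ) : ℂ :=
  ∑ ν ∈ (range Nβ).filter (fun ν => Nat.Coprime ν Nβ), χ (ν : ZMod Nβ) *
    ∑ d ∈ (range c).filter (fun d => Nat.Coprime d c),
      ∑ r ∈ Fintype.piFinset (fun _ : Fin m => range c),
        eQ (((adInv c d : ℚ) * Qf S (ν • β + fun i => (r i : ℚ))
            - bil S γ (ν • β + fun i => (r i : ℚ))
            + (d : ℚ) * (Qf S γ + n)) / c)

/-- The Gauss sum `G(χ) = ∑_{u mod N, gcd(u,N)=1} χ(u) e(u/N)`. -/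
noncomputable def gaussS (N : ℕ) (χ : DirichletCharacter ℂ N) : ℂ :=
  ∑ u ∈ (range N).filter (fun u => Nat.Coprime u N), χ (u : ZMod N) * eQ (u / N)


theorem bil_add_smul_right (S : Matrix (Fin m) (Fin m) ℤ) (x y z : Fin m → ℚ) (k : ℕ) :
    bil S x (k • y + z) = k * bil S x y + bil S x z := by
  simp only [bil, ← Nat.cast_smul_eq_nsmul ℚ, mulVec_add, mulVec_smul, dotProduct_add,
    dotProduct_smul, smul_eq_mul]

theorem bil_comm {S : Matrix (Fin m) (Fin m) ℤ} (hS : S.IsSymm) (x y : Fin m → ℚ) :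
    bil S x y = bil S y x := by
  have h : (S.map (Int.cast : ℤ → ℚ))ᵀ = S.map (Int.cast : ℤ → ℚ) := (hS.map _).eq
  rw [bil, bil, dotProduct_mulVec, dotProduct_comm, ← mulVec_transpose, h]

theorem Qf_smul_add {S : Matrix (Fin m) (Fin m) ℤ} (hS : S.IsSymm) (x y : Fin m → ℚ) (k : ℕ) :
    Qf S (k • x + y) = k ^ 2 * Qf S x + k * bil S x y + Qf S y := by
  rw [Qf, Qf, Qf, bil_add_smul_right, bil_comm hS (k • x + y) x, bil_comm hS (k • x + y) y,
    bil_add_smul_right, bil_add_smul_right, bil_comm hS y x]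
  ring

theorem eQ_eq_of_sub_eq_int {x y : ℚ} (k : ℤ) (h : x - y = k) : eQ x = eQ y := by
  obtain rfl : x = y + k := by linarith
  rw [eQ, eQ, Complex.exp_eq_exp_iff_exists_int]
  exact ⟨k, by push_cast; ring⟩

/-- A weighted sum of a primitive Dirichlet character against a function whose period is a proper
divisor of the modulus vanishes. -/
theorem sum_primitive_mul_periodic_eq_zero {N M : ℕ} [NeZero N] (hMN : M ∣ N) (hlt : M < N)
    {χ : DirichletCharacter ℂ N} (hχ : χ.IsPrimitive) {F : ℕ → ℂ} (hF : Function.Periodic F M) :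
    ∑ ν ∈ (range N).filter (fun ν => Nat.Coprime ν N), χ (ν : ZMod N) * F ν = 0 := by
  obtain ⟨u, hu, hχu⟩ : ∃ u : (ZMod N)ˣ, ZMod.unitsMap hMN u = 1 ∧ χ u ≠ 1 := by
    by_contra! h
    have hfac : χ.FactorsThrough M := by
      rw [DirichletCharacter.factorsThrough_iff_ker_unitsMap hMN]
      intro u hu
      rw [MonoidHom.mem_ker] at hu ⊢
      ext
      simpa using h u hu
    have hle : χ.conductor ≤ M := Nat.sInf_le hfac
    rw [hχ] at hle
    omega
  have hsum : ∑ ν ∈ (range N).filter (fun ν => Nat.Coprime ν N), χ (ν : ZMod N) * F ν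
      = ∑ x : ZMod N, χ x * F x.val := by
    rw [sum_filter_of_ne]
    · refine sum_nbij' (fun ν => (ν : ZMod N)) ZMod.val (by simp)
        (fun x _ => mem_range.2 x.val_lt) ?_ (by simp) ?_
      · intro ν hν
        exact ZMod.val_cast_of_lt (mem_range.1 hν)
      · intro ν hν
        rw [ZMod.val_cast_of_lt (mem_range.1 hν)]
    · intro ν _ hne
      rw [← ZMod.isUnit_iff_coprime]
      by_contra hν
      exact hne (by rw [χ.map_nonunit hν, zero_mul])
  have hFu (x : ZMod N) : F ((u : ZMod N) * x).val = F x.val := by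
    rw [← hF.map_mod_nat, ← hF.map_mod_nat x.val]
    congr 1
    change _ ≡ _ [MOD M]
    rw [← ZMod.natCast_eq_natCast_iff]
    have hval (y : ZMod N) : ((y.val : ℕ) : ZMod M) = ZMod.castHom hMN (ZMod M) y := by
      rw [ZMod.castHom_apply, ZMod.natCast_val]
    have hu' : ZMod.castHom hMN (ZMod M) u = 1 := congrArg Units.val hu
    rw [hval, hval, map_mul, hu', one_mul]
  rw [hsum]
  have hmul : χ u * ∑ x : ZMod N, χ x * F x.val = ∑ x : ZMod N, χ x * F x.val := by
    rw [mul_sum]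
    refine Fintype.sum_equiv (Units.mulLeft u) _ _ fun x => ?_
    rw [Units.mulLeft_apply, hFu, map_mul, mul_assoc]
  by_contra hne
  exact hχu (mul_right_cancel₀ hne (by rw [hmul, one_mul]))

/-- vanishing of `G_{γ,n}(p^α; β, χ)` for `0 ≤ α < ν_p(g)`. -/
theorem Gsum_vanish_small (m : ℕ) (hm : 1 ≤ m) (S : Matrix (Fin m) (Fin m) ℤ)
    (hSsymm : S.IsSymm) (hSeven : ∀ i, 2 ∣ S i i) (hSdet : S.det ≠ 0)
    (γ : Fin m → ℚ) (hγ : memDual S γ) (n : ℚ) (hn : ∃ z : ℤ, n + Qf S γ = z)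
    (β : Fin m → ℚ) (hβ : memDual S β) (hβiso : ∃ z : ℤ, Qf S β = z)
    (Nβ : ℕ) (hNβ : isOrderOf β Nβ)
    (χ : DirichletCharacter ℂ Nβ) (hχ : χ.IsPrimitive)
    (b : ℤ) (hb : (b : ℚ) = Nβ * bil S γ β)
    (p : ℕ) (hp : p.Prime) (hpg : p ∣ Int.gcd (Nβ : ℤ) b)
    (v : ℕ) (hv : Nβ = p ^ v)
    (α : ℕ) (hα : α < padicValNat p (Int.gcd (Nβ : ℤ) b)) :
    Gsum S γ n β Nβ χ (p ^ α) = 0 := by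
  have hdvd : p ^ (α + 1) ∣ Int.gcd (Nβ : ℤ) b := (pow_dvd_pow p hα).trans pow_padicValNat_dvd
  have hdvdN : p ^ (α + 1) ∣ p ^ v := hv ▸ Int.natCast_dvd_natCast.1
    ((Int.natCast_dvd_natCast.2 hdvd).trans (Int.gcd_dvd_left _ _))
  obtain ⟨s, rfl⟩ : ∃ s, v = α + s + 1 := by
    have := (Nat.pow_dvd_pow_iff_le_right hp.one_lt).1 hdvdN
    exact ⟨v - α - 1, by omega⟩
  obtain ⟨t, ht⟩ := (Int.natCast_dvd_natCast.2 hdvd).trans (Int.gcd_dvd_right (Nβ : ℤ) b)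
  have hp0 : (p : ℚ) ≠ 0 := by exact_mod_cast hp.ne_zero
  have hγβ : bil S γ β = t / p ^ s := by
    rw [ht, hv] at hb
    push_cast at hb
    field_simp
    refine mul_left_cancel₀ (pow_ne_zero (α + 1) hp0) ?_
    rw [hb]
    ring
  obtain ⟨q, hq⟩ := hβiso
  have : NeZero Nβ := ⟨hNβ.1.ne'⟩
  refine sum_primitive_mul_periodic_eq_zero (M := p ^ (α + s)) (hv ▸ pow_dvd_pow p (by omega))
    (hv ▸ Nat.pow_lt_pow_right hp.one_lt (by omega)) hχ fun ν => ?_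
  refine sum_congr rfl fun d _ => sum_congr rfl fun r _ => ?_
  obtain ⟨l, hl⟩ := hβ fun i => r i
  simp only [Int.cast_natCast] at hl
  rw [Qf_smul_add hSsymm, Qf_smul_add hSsymm, bil_add_smul_right, bil_add_smul_right, hγβ, hq, hl]
  refine eQ_eq_of_sub_eq_int
    (adInv (p ^ α) d * p ^ s * ((2 * ν + p ^ (α + s)) * q + l) - t) ?_
  push_cast
  field_simp
  ring

end EisensteinWeil
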